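/- arXiv:0902.0054 — 2 statements merged into one kernel-verified Lean document; each statement's English description precedes it below -/
import Mathlib

section
/- For every real λ ≥ 1 and every natural number n, the normalized even moment m_{2n}^{λ} := c_λ^{-1} ∫_{-2}^{2} x^{2n} cos[(1 - 1/λ) arcsin(x/2)] (4-x²)^{-1/(2λ)} dx equals p_n(1/λ), where p_n is the polynomial p_n(y) = Σ_{k=0}^{n} C(n,k) · 4^{n-k} · (1/k!) · Π_{j=k+2}^{2k+1} (y - j) (the product over j from k+2 to 2k+1 has k factors and is empty, equal to 1, when k = 0). In particular the moments m_{2n}^{λ} are polynomials in the variable 1/λ. -/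
open Real MeasureTheory

lemma constPi (l : ℝ) (hl : 1 ≤ l) : (2 : ℝ) ^ (1 - 1 / l) * Real.sqrt Real.pi * Real.Gamma (1 - 1 / (2 * l)) *
          Real.Gamma (3 / 2 - 1 / (2 * l)) / Real.Gamma (2 - 1 / l) = π := by
  have hl0 : 0 < l := by linarith
  have h1 : 1 / l ≤ 1 := by rw [div_le_one hl0]; exact hl
  have h := Real.Gamma_mul_Gamma_add_half (1 - 1 / (2 * l))
  have e1 : (1 - 1 / (2 * l)) + 1/2 = 3 / 2 - 1 / (2 * l) := by ring
  have e2 : 2 * (1 - 1 / (2 * l)) = 2 - 1 / l := by field_simp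
  rw [e1, e2] at h
  have hG : Real.Gamma (2 - 1 / l) ≠ 0 := (Real.Gamma_pos_of_pos (by linarith)).ne'
  rw [mul_assoc, h, div_eq_iff hG]
  have e3 : (2:ℝ) ^ (1 - 1 / l) * 2 ^ (1 - (2 - 1 / l)) = 1 := by
    rw [← Real.rpow_add two_pos]; ring_nf; simp
  have e4 : √π * √π = π := Real.mul_self_sqrt pi_pos.le
  linear_combination (Real.Gamma (2 - 1 / l) * √π * √π) * e3 + Real.Gamma (2 - 1 / l) * e4

lemma cosnn {t : ℝ} (ht : t ∈ Set.Icc (-(π/2)) (π/2)) : 0 ≤ 2 * cos t := by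
  have := cos_nonneg_of_mem_Icc ht
  linarith

lemma base_pos (b : ℝ) (hb : 0 < b) :
    ∫ t in (-(π/2))..(π/2), (2 * cos t) ^ b * cos (b * t) = π := by
  set f : ℂ → ℂ := fun z => (1 + z) ^ (b : ℂ) with hf
  have hcont : ∀ z : ℂ, ‖z‖ ≤ 1 → ContinuousAt f z := by
    intro z hz
    have : ContinuousAt (fun x : ℂ => x ^ (b : ℂ)) (1 + z) := by
      apply Complex.continuousAt_cpow_const_of_re_pos
      · left
        have := Complex.abs_re_le_norm z
        have := neg_abs_le z.re
        simp only [Complex.add_re, Complex.one_re]; linarith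
      · simpa using hb
    exact ContinuousAt.comp (f := fun z : ℂ => 1 + z) this (by fun_prop)
  have hmv : circleAverage f 0 1 = f 0 := by
    apply circleAverage_of_differentiable_on_off_countable Set.countable_empty
    · intro z hz
      exact (hcont z (by simpa using hz)).continuousWithinAt
    · intro z hz
      have hz : ‖z‖ < 1 := by simpa using hz.1
      have : 1 + z ∈ Complex.slitPlane := by
        left
        have := Complex.abs_re_le_norm z
        have := neg_abs_le z.re
        simp only [Complex.add_re, Complex.one_re]; linarith
      exact DifferentiableAt.cpow (by fun_prop) (by fun_prop) this
  rw [circleAverage_eq_integral_add (-π), ] at hmv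
  have h2 : ∫ t in (-(π/2))..(π/2), f (circleMap 0 1 (2 * t)) = π := by
    rw [intervalIntegral.integral_comp_mul_left (fun t => f (circleMap 0 1 t)) two_ne_zero]
    have h3 := intervalIntegral.integral_comp_add_right (a := 0) (b := 2 * π) (fun t => f (circleMap 0 1 t)) (-π)
    rw [h3] at hmv
    have e1 : 2 * -(π/2) = 0 + -π := by ring
    have e2 : 2 * (π/2) = 2 * π + -π := by ring
    rw [e1, e2]
    have hf0 : f 0 = 1 := by simp [hf]
    rw [hf0] at hmv
    generalize (∫ x in (0 + -π)..(2 * π + -π), f (circleMap 0 1 x)) = J at hmv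
    have : J = 2 * π := by
      have hp : (π : ℂ) ≠ 0 := by exact_mod_cast pi_ne_zero
      simp only [Complex.real_smul] at hmv
      push_cast at hmv
      field_simp at hmv
      rw [hmv]
    rw [this]; simp
  have hci : Continuous (fun t : ℝ => f (circleMap 0 1 (2 * t))) := by
    rw [continuous_iff_continuousAt]
    intro t
    exact ContinuousAt.comp (f := fun t : ℝ => circleMap 0 1 (2 * t)) (hcont _ (by simp)) (by fun_prop)
  have h4 := Complex.reCLM.intervalIntegral_comp_comm (hci.intervalIntegrable (μ := volume) (-(π/2)) (π/2))
  rw [h2] at h4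
  simp only [Complex.reCLM_apply, Complex.ofReal_re] at h4
  refine Eq.trans ?_ h4
  apply intervalIntegral.integral_congr
  intro t ht
  rw [Set.uIcc_of_le (by linarith [pi_pos])] at ht
  have hc : 0 ≤ 2 * cos t := cosnn ht
  have key : 1 + circleMap 0 1 (2 * t) = ((2 * cos t : ℝ) : ℂ) * Complex.exp (t * Complex.I) := by
    simp only [circleMap]
    push_cast
    rw [Complex.two_cos, add_mul, ← Complex.exp_add, ← Complex.exp_add]
    ring_nf; simp [add_comm]
  simp only [hf]
  rw [key]
  rcases hc.eq_or_lt with h0 | h0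
  · rw [← h0]; simp [hb.ne', Real.zero_rpow]
  · rw [Complex.cpow_def_of_ne_zero (mul_ne_zero (by exact_mod_cast h0.ne') (Complex.exp_ne_zero _)),
      Complex.log_ofReal_mul h0 (Complex.exp_ne_zero _),
      Complex.log_exp (by simp; linarith [ht.1, pi_pos]) (by simp; linarith [ht.2, pi_pos]),
      Real.rpow_def_of_pos h0, Complex.exp_re]
    simp [mul_comm]

lemma base (b : ℝ) (hb : 0 ≤ b) :
    ∫ t in (-(π/2))..(π/2), (2 * cos t) ^ b * cos (b * t) = π := by
  rcases hb.eq_or_lt with h0 | h0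
  · rw [← h0]; simp
  · exact base_pos b h0

lemma recur (b s : ℝ) (hs : 0 ≤ s) :
    ((s+2)^2 - b^2) * ∫ t in (-(π/2))..(π/2), (2 * cos t) ^ (s+2) * cos (b * t) =
    4 * (s+2) * (s+1) * ∫ t in (-(π/2))..(π/2), (2 * cos t) ^ s * cos (b * t) := by
  have hC : ∀ r : ℝ, 0 ≤ r → Continuous (fun t : ℝ => (2 * cos t) ^ r) := fun r hr =>
    Continuous.rpow_const (by fun_prop) (fun _ => Or.inr hr)
  have c0 := hC s hs
  have c1 := hC (s+1) (by linarith)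
  have c2 := hC (s+2) (by linarith)
  have hab : -(π/2) ≤ π/2 := by linarith [pi_pos]
  have h := intervalIntegral.integral_eq_sub_of_hasDerivAt_of_le hab
    (f := fun t => (s+2) * ((2 * cos t)^(s+1) * (2 * sin t) * cos (b*t)) - b * ((2 * cos t)^(s+2) * sin (b * t)))
    (f' := fun t => ((s+2)^2 - b^2) * ((2 * cos t) ^ (s+2) * cos (b * t)) -
       4 * (s+2) * (s+1) * ((2 * cos t) ^ s * cos (b * t))) (by fun_prop) ?_ ?_
  · rw [intervalIntegral.integral_sub (Continuous.intervalIntegrable (by fun_prop) _ _) (Continuous.intervalIntegrable (by fun_prop) _ _), intervalIntegral.integral_const_mul, intervalIntegral.integral_const_mul] at h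
    simp only [cos_neg, cos_pi_div_two, mul_zero] at h
    rw [Real.zero_rpow (by linarith), Real.zero_rpow (by linarith)] at h
    linear_combination h
  · intro t ht
    have hp : 0 < 2 * cos t := by linarith [cos_pos_of_mem_Ioo ht]
    have d0 : HasDerivAt (fun t => 2 * cos t) (2 * (- sin t)) t := (hasDerivAt_cos t).const_mul 2
    have d1 := d0.rpow_const (p := s+1) (Or.inl hp.ne')
    have d2 := d0.rpow_const (p := s+2) (Or.inl hp.ne')
    have db : HasDerivAt (fun t => b * t) b t := by simpa using (hasDerivAt_id t).const_mul b
    have := (((d1.mul ((hasDerivAt_sin t).const_mul 2)).mul db.cos).const_mul (s+2)).sub ((d2.mul db.sin).const_mul b)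
    refine this.congr_deriv ?_
    have e1 : (2 * cos t)^(s+1) = (2 * cos t)^s * (2 * cos t) := by rw [Real.rpow_add_one hp.ne']
    have e2 : (2 * cos t)^(s+2) = (2 * cos t)^s * (2 * cos t)^2 := by rw [Real.rpow_add hp]; norm_num
    have e3 : s + 1 - 1 = s := by ring
    have e4 : s + 2 - 1 = s + 1 := by ring
    simp only [Pi.mul_apply]
    rw [e3, e4, e1, e2]
    have hsc := sin_sq_add_cos_sq t
    generalize (2 * cos t)^s = X
    linear_combination (-4 * (s+2)*(s+1)*X*cos (b*t)) * hsc
  · exact Continuous.intervalIntegrable (by fun_prop) _ _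

lemma Ik (b : ℝ) (hb : 0 ≤ b) (k : ℕ) :
    ∫ t in (-(π/2))..(π/2), (2 * cos t) ^ (b + 2 * k) * cos (b * t) =
      π * ((1 / (Nat.factorial k : ℝ)) * ∏ j ∈ Finset.Icc (k + 2) (2 * k + 1), (b - 1 + (j : ℝ))) := by
  induction k with
  | zero => simpa using base b hb
  | succ k ih =>
    have h := recur b (b + 2 * k) (by positivity)
    rw [ih] at h
    have e : b + 2 * ((k + 1 : ℕ) : ℝ) = b + 2 * k + 2 := by push_cast; ring
    rw [e]
    generalize (∫ t in (-(π/2))..(π/2), (2 * cos t) ^ (b + 2 * k + 2) * cos (b * t)) = J at h ⊢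
    have p1 : (∏ j ∈ Finset.Icc (k + 2) (2 * k + 1), (b - 1 + (j : ℝ))) * (b + 2 * k + 1) * (b + 2 * k + 2)
       = (b + k + 1) * ∏ j ∈ Finset.Icc (k + 1 + 2) (2 * (k + 1) + 1), (b - 1 + (j : ℝ)) := by
      rw [show 2 * (k+1) + 1 = 2 * k + 1 + 1 + 1 by ring]
      have q : (∏ j ∈ Finset.Icc (k + 2) (2 * k + 1 + 1 + 1), (b - 1 + (j : ℝ))) = _ := 
        (Finset.mul_prod_Ioc_eq_prod_Icc (a := k + 2) (b := 2 * k + 1 + 1 + 1) (f := fun j : ℕ => (b - 1 + (j : ℝ))) (by omega)).symm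
      rw [Finset.prod_Icc_succ_top (by omega), Finset.prod_Icc_succ_top (by omega)] at q
      have q2 : Finset.Ioc (k+2) (2 * k + 1 + 1 + 1) = Finset.Icc (k+1+2) (2 * k + 1 + 1 + 1) := by
        ext; simp; omega
      rw [q2] at q
      push_cast at q
      linear_combination q
    generalize (∏ j ∈ Finset.Icc (k + 1 + 2) (2 * (k + 1) + 1), (b - 1 + (j : ℝ))) = Q at *
    generalize (∏ j ∈ Finset.Icc (k + 2) (2 * k + 1), (b - 1 + (j : ℝ))) = P at *
    have hk : (0:ℝ) ≤ k := Nat.cast_nonneg k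
    have hfac : (Nat.factorial k : ℝ) ≠ 0 := by positivity
    have hbk : b + k + 1 ≠ 0 := by positivity
    rw [Nat.factorial_succ]; push_cast
    have hk1 : (k:ℝ) + 1 ≠ 0 := by positivity
    field_simp at h ⊢
    apply mul_left_cancel₀ hbk
    linear_combination (1/4) * h + π * p1

lemma sin_substitution (l : ℝ) (hl : 1 ≤ l) (n : ℕ) :
    ∫ x in (-2 : ℝ)..2, x ^ (2 * n) * Real.cos ((1 - 1 / l) * Real.arcsin (x / 2)) *
        (4 - x ^ 2) ^ (-(1 / (2 * l))) =
    ∫ t in (-(π/2))..(π/2), (2 * sin t)^(2*n) * ((2 * cos t) ^ (1 - 1/l) * cos ((1 - 1/l) * t)) := by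
  rw [intervalIntegral.integral_of_le (by norm_num), intervalIntegral.integral_of_le (by linarith [pi_pos]),
    integral_Ioc_eq_integral_Ioo, integral_Ioc_eq_integral_Ioo]
  have him : (fun t => 2 * sin t) '' Set.Ioo (-(π/2)) (π/2) = Set.Ioo (-2) 2 := by
    ext x
    constructor
    · rintro ⟨t, ht, rfl⟩
      have h1 := strictMonoOn_sin (Set.left_mem_Icc.2 (by linarith [pi_pos])) (Set.Ioo_subset_Icc_self ht) ht.1
      have h2 := strictMonoOn_sin (Set.Ioo_subset_Icc_self ht) (Set.right_mem_Icc.2 (by linarith [pi_pos])) ht.2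
      simp at h1 h2
      constructor <;> simp <;> linarith
    · intro hx
      refine ⟨arcsin (x/2), ⟨?_, ?_⟩, ?_⟩
      · rw [neg_pi_div_two_lt_arcsin]; linarith [hx.1]
      · rw [arcsin_lt_pi_div_two]; linarith [hx.2]
      · simp only; rw [sin_arcsin (by linarith [hx.1]) (by linarith [hx.2])]; ring
  rw [← him, integral_image_eq_integral_abs_deriv_smul measurableSet_Ioo
    (f' := fun t => 2 * cos t) (fun t _ => ((hasDerivAt_sin t).const_mul 2).hasDerivWithinAt)]
  · apply setIntegral_congr_fun measurableSet_Ioo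
    intro t ht
    have hp : 0 < 2 * cos t := by linarith [cos_pos_of_mem_Ioo ht]
    simp only [smul_eq_mul]
    rw [abs_of_pos hp, mul_div_cancel_left₀ _ two_ne_zero, arcsin_sin ht.1.le ht.2.le]
    have e : 4 - (2 * sin t)^2 = (2 * cos t)^(2:ℝ) := by
      rw [Real.rpow_two]; linear_combination (-4) * sin_sq_add_cos_sq t
    rw [e, ← Real.rpow_mul hp.le]
    have e2 : 2 * -(1 / (2 * l)) = - (1/l) := by field_simp
    rw [e2, show 1 - 1/l = -(1/l) + 1 by ring, Real.rpow_add_one hp.ne']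
    ring
  · intro x hx y hy hxy
    exact injOn_sin (Set.Ioo_subset_Icc_self hx) (Set.Ioo_subset_Icc_self hy) (by simpa using hxy)

theorem stmt_12 (l : ℝ) (hl : 1 ≤ l) (n : ℕ) :
    ((2 : ℝ) ^ (1 - 1 / l) * Real.sqrt Real.pi * Real.Gamma (1 - 1 / (2 * l)) *
          Real.Gamma (3 / 2 - 1 / (2 * l)) / Real.Gamma (2 - 1 / l))⁻¹ *
      ∫ x in (-2 : ℝ)..2, x ^ (2 * n) * Real.cos ((1 - 1 / l) * Real.arcsin (x / 2)) *
        (4 - x ^ 2) ^ (-(1 / (2 * l))) =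
      ∑ k ∈ Finset.range (n + 1), (n.choose k : ℝ) * (4 : ℝ) ^ (n - k) *
        (1 / (Nat.factorial k : ℝ)) *
        ∏ j ∈ Finset.Icc (k + 2) (2 * k + 1), (1 / l - (j : ℝ)) := by
  have hb : 0 ≤ 1 - 1 / l := by
    rw [sub_nonneg, div_le_one (by linarith)]; exact hl
  rw [constPi l hl, sin_substitution l hl n]
  have hint : ∫ t in (-(π/2))..(π/2), (2 * sin t)^(2*n) * ((2 * cos t) ^ (1 - 1/l) * cos ((1 - 1/l) * t))
    = ∫ t in (-(π/2))..(π/2), ∑ k ∈ Finset.range (n + 1), ((n.choose k : ℝ) * (4 : ℝ) ^ (n - k) * (-1)^k) *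
       ((2 * cos t) ^ (1 - 1/l + 2 * k) * cos ((1 - 1/l) * t)) := by
    apply intervalIntegral.integral_congr_ae
    have : ∀ᵐ t : ℝ, t ≠ π/2 := by simp [ae_iff]
    filter_upwards [this] with t htn ht
    rw [Set.uIoc_of_le (by linarith [pi_pos])] at ht
    have hp : 0 < 2 * cos t := by linarith [cos_pos_of_mem_Ioo ⟨ht.1, lt_of_le_of_ne ht.2 htn⟩]
    have e : (2 * sin t)^2 = -(2 * cos t)^2 + 4 := by linear_combination 4 * sin_sq_add_cos_sq t
    rw [pow_mul, e, add_pow, Finset.sum_mul]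
    apply Finset.sum_congr rfl
    intro k _
    have e2 : (2 * cos t) ^ (1 - 1/l + 2 * k) = (2 * cos t) ^ (1 - 1/l) * ((2 * cos t)^2)^k := by
      rw [Real.rpow_add hp, ← pow_mul]
      congr 1
      exact_mod_cast Real.rpow_natCast (2 * cos t) (2 * k)
    rw [e2, neg_pow]; ring
  rw [hint, intervalIntegral.integral_finsetSum, Finset.mul_sum]
  · apply Finset.sum_congr rfl
    intro k _
    rw [intervalIntegral.integral_const_mul, Ik _ hb]
    have : ∏ j ∈ Finset.Icc (k + 2) (2 * k + 1), (1 / l - (j : ℝ)) =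
       (-1)^k * ∏ j ∈ Finset.Icc (k + 2) (2 * k + 1), (1 - 1 / l - 1 + (j : ℝ)) := by
      have hc : (Finset.Icc (k + 2) (2 * k + 1)).card = k := by simp; omega
      rw [Finset.prod_congr rfl (fun (j : ℕ) _ => show (1 / l - (j : ℝ)) = (-1) * (1 - 1 / l - 1 + (j : ℝ)) by ring),
        Finset.prod_mul_distrib, Finset.prod_const, hc]
    rw [this]
    have := pi_ne_zero
    field_simp
  · intro k _
    have : Continuous (fun t : ℝ => (2 * cos t) ^ (1 - 1/l + 2 * k)) :=
      Continuous.rpow_const (by fun_prop) (fun _ => Or.inr (by positivity))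
    exact Continuous.intervalIntegrable (by fun_prop) _ _
end

section
/- For all real p > 0 and q > 0 with p + q > 1, ∫_{0}^{π/2} cos((p-q)x) · (cos x)^{p+q-2} dx = π Γ(p+q-1) / (2^{p+q-1} Γ(p) Γ(q)). -/
open Real Set Filter Topology MeasureTheory in
lemma aux_int (s : ℝ) (hs : 0 < s) :
    IntervalIntegrable (fun x => Real.cos x ^ (s - 1)) volume 0 (π / 2) := by
  have hpi : (0:ℝ) ≤ π / 2 := by positivity
  have hc : Continuous (fun x => Real.cos x ^ s) :=
    Real.continuous_cos.rpow_const (fun x => Or.inr hs.le)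
  have h1 : IntervalIntegrable (fun x => Real.sin x * s * Real.cos x ^ (s - 1)) volume 0 (π / 2) := by
    apply intervalIntegral.intervalIntegrable_deriv_of_nonneg (g := fun x => - Real.cos x ^ s)
    · exact hc.neg.continuousOn
    · intro x hx
      rw [min_eq_left hpi, max_eq_right hpi] at hx
      have hcx : 0 < Real.cos x := Real.cos_pos_of_mem_Ioo ⟨by linarith [hx.1], hx.2⟩
      have := ((Real.hasDerivAt_cos x).rpow_const (p := s) (Or.inl hcx.ne')).neg
      convert! this using 1
      ring
    · intro x hx
      rw [min_eq_left hpi, max_eq_right hpi] at hx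
      have hcx : 0 < Real.cos x := Real.cos_pos_of_mem_Ioo ⟨by linarith [hx.1], hx.2⟩
      have hsx : 0 < Real.sin x := Real.sin_pos_of_pos_of_lt_pi hx.1 (by linarith [hx.2, Real.pi_pos])
      positivity
  have h2 : IntervalIntegrable (fun x => s⁻¹ * (Real.sin x * s * Real.cos x ^ (s - 1)) + Real.cos x ^ s)
      volume 0 (π / 2) := (h1.const_mul _).add (hc.intervalIntegrable _ _)
  refine h2.mono_fun ?_ ?_
  · exact ((Real.measurable_cos.pow_const (s-1))).aestronglyMeasurable
  · rw [uIoc_of_le hpi, ← restrict_Ioo_eq_restrict_Ioc]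
    filter_upwards [ae_restrict_mem measurableSet_Ioo] with x hx
    have hcx : 0 < Real.cos x := Real.cos_pos_of_mem_Ioo ⟨by linarith [hx.1], hx.2⟩
    have hsx : 0 < Real.sin x := Real.sin_pos_of_pos_of_lt_pi hx.1 (by linarith [hx.2, Real.pi_pos])
    have e : s⁻¹ * (Real.sin x * s * Real.cos x ^ (s - 1)) + Real.cos x ^ s
        = (Real.sin x + Real.cos x) * Real.cos x ^ (s - 1) := by
      have : Real.cos x ^ s = Real.cos x * Real.cos x ^ (s-1) := by
        conv_lhs => rw [show s = 1 + (s - 1) by ring, Real.rpow_add hcx, Real.rpow_one]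
      rw [this]; field_simp
    rw [e]
    have hp : 0 < Real.cos x ^ (s-1) := by positivity
    rw [Real.norm_of_nonneg hp.le, Real.norm_of_nonneg (by positivity)]
    have : 1 ≤ Real.sin x + Real.cos x := by nlinarith [Real.sin_sq_add_cos_sq x]
    nlinarith

open Real Set Filter Topology MeasureTheory in
lemma aux_rec (s b : ℝ) (hs : 0 < s) :
    s * ∫ x in (0 : ℝ)..(π / 2), Real.cos ((b + 1) * x) * Real.cos x ^ (s - 1) =
    (s - b) * ∫ x in (0 : ℝ)..(π / 2), Real.cos (b * x) * Real.cos x ^ s := by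
  have hpi : (0:ℝ) ≤ π / 2 := by positivity
  have hc : Continuous (fun x => Real.cos x ^ s) :=
    Real.continuous_cos.rpow_const (fun x => Or.inr hs.le)
  have i1 : IntervalIntegrable (fun x => Real.cos ((b + 1) * x) * Real.cos x ^ (s - 1)) volume 0 (π / 2) :=
    (aux_int s hs).continuousOn_mul (by fun_prop)
  have i2 : IntervalIntegrable (fun x => Real.cos (b * x) * Real.cos x ^ s) volume 0 (π / 2) := by
    apply Continuous.intervalIntegrable
    exact (by fun_prop : Continuous fun x => Real.cos (b * x)).mul hc
  have key : ∫ x in (0 : ℝ)..(π / 2), (s * (Real.cos ((b + 1) * x) * Real.cos x ^ (s - 1)) -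
      (s - b) * (Real.cos (b * x) * Real.cos x ^ s)) = 
      Real.sin (b * (π/2)) * Real.cos (π/2) ^ s - Real.sin (b * 0) * Real.cos 0 ^ s := by
    apply intervalIntegral.integral_eq_sub_of_hasDerivAt_of_le hpi
      (f := fun x => Real.sin (b * x) * Real.cos x ^ s)
    · exact ((by fun_prop : Continuous fun x => Real.sin (b * x)).mul hc).continuousOn
    · intro x hx
      have hcx : 0 < Real.cos x := Real.cos_pos_of_mem_Ioo ⟨by linarith [hx.1], hx.2⟩
      have d1 := (Real.hasDerivAt_cos x).rpow_const (p := s) (Or.inl hcx.ne')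
      have d2 := ((hasDerivAt_id x).const_mul b).sin
      have d3 := d2.mul d1
      convert! d3 using 1
      have : Real.cos x ^ s = Real.cos x * Real.cos x ^ (s-1) := by
        conv_lhs => rw [show s = 1 + (s - 1) by ring, Real.rpow_add hcx, Real.rpow_one]
      rw [this, add_mul, one_mul, Real.cos_add]
      simp only [id]
      ring
    · exact (i1.const_mul _).sub (i2.const_mul _)
  rw [intervalIntegral.integral_sub (i1.const_mul _) (i2.const_mul _),
    intervalIntegral.integral_const_mul, intervalIntegral.integral_const_mul,
    Real.cos_pi_div_two, Real.zero_rpow hs.ne'] at key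
  simp at key
  linarith

open Real Set Filter Topology MeasureTheory in
lemma aux_rec' (s b : ℝ) (hs : 0 < s) :
    s * ∫ x in (0 : ℝ)..(π / 2), Real.cos ((b - 1) * x) * Real.cos x ^ (s - 1) =
    (s + b) * ∫ x in (0 : ℝ)..(π / 2), Real.cos (b * x) * Real.cos x ^ s := by
  have h := aux_rec s (-b) hs
  have e1 : ∀ x : ℝ, Real.cos ((-b+1) * x) = Real.cos ((b - 1) * x) := fun x => by
    rw [← Real.cos_neg]; ring_nf
  have e2 : ∀ x : ℝ, Real.cos (-b * x) = Real.cos (b * x) := fun x => by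
    rw [← Real.cos_neg]; ring_nf
  simpa only [e1, e2, sub_neg_eq_add] using h

open Real Set Filter Topology MeasureTheory in
lemma aux_lim (c b : ℝ) (hc : 0 < c) :
    Tendsto (fun n : ℕ => √(n:ℝ) * ∫ x in (0 : ℝ)..(π / 2), Real.cos (b * x) * Real.cos x ^ (c + 2 * n))
      atTop (𝓝 (√π / 2)) := by
  have hg := integral_gaussian_Ioi 1
  rw [div_one] at hg
  rw [← hg]
  let F : ℕ → ℝ → ℝ := fun n => indicator (Ioc 0 (√(n:ℝ) * (π/2)))
    (fun y => Real.cos (b * (y / √(n:ℝ))) * Real.cos (y / √(n:ℝ)) ^ (c + 2 * n))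
  have hF : ∀ n : ℕ, √(n:ℝ) * ∫ x in (0 : ℝ)..(π / 2), Real.cos (b * x) * Real.cos x ^ (c + 2 * n)
      = ∫ y in Ioi 0, F n y := by
    intro n
    rw [setIntegral_indicator measurableSet_Ioc, inter_eq_self_of_subset_right Ioc_subset_Ioi_self,
      ← intervalIntegral.integral_of_le (by positivity)]
    rcases Nat.eq_zero_or_pos n with rfl | hn
    · simp
    have hn' : √(n:ℝ) ≠ 0 := by positivity
    rw [intervalIntegral.integral_comp_div (fun x => Real.cos (b * x) * Real.cos x ^ (c + 2 * n)) hn']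
    rw [zero_div, mul_div_cancel_left₀ _ hn', smul_eq_mul]
  simp_rw [hF]
  apply tendsto_integral_of_dominated_convergence (fun y => Real.exp (-(4/π^2) * y^2))
  · intro n
    apply Measurable.aestronglyMeasurable
    refine Measurable.indicator ?_ measurableSet_Ioc
    fun_prop
  · exact (integrable_exp_neg_mul_sq (by positivity)).integrableOn
  · intro n
    refine ae_of_all _ fun y => ?_
    simp only [F]
    by_cases hy : y ∈ Ioc 0 (√(n:ℝ) * (π/2))
    · rw [indicator_of_mem hy]
      have hn : 0 < √(n:ℝ) := by
        by_contra h
        have : √(n:ℝ) = 0 := le_antisymm (not_lt.1 h) (Real.sqrt_nonneg _)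
        rw [this] at hy
        simp at hy
      have hnn : √(n:ℝ) ^ 2 = n := Real.sq_sqrt (by positivity)
      set t := y / √(n:ℝ) with ht
      have hyt : y = t * √(n:ℝ) := by rw [ht]; field_simp
      have t0 : 0 ≤ t := div_nonneg hy.1.le hn.le
      have t1 : t ≤ π/2 := by rw [ht, div_le_iff₀ hn]; linarith [hy.2]
      have hct : 0 ≤ Real.cos t := Real.cos_nonneg_of_mem_Icc ⟨by linarith, t1⟩
      have hst := Real.mul_le_sin t0 t1
      have hsq : Real.cos t ^ 2 ≤ Real.exp (-(4/π^2) * t^2) := by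
        have h1 : (2/π*t)^2 ≤ Real.sin t ^2 := by gcongr
        have h2 := Real.add_one_le_exp (-(4/π^2) * t^2)
        have h3 : (2/π*t)^2 = (4/π^2) * t^2 := by ring
        nlinarith [Real.sin_sq_add_cos_sq t]
      have e : Real.cos t ^ (c + 2 * (n:ℝ)) = Real.cos t ^ c * (Real.cos t ^ 2) ^ n := by
        rw [Real.rpow_add_of_nonneg hct hc.le (by positivity)]
        congr 1
        rw [← pow_mul, ← Real.rpow_natCast]
        push_cast
        rfl
      rw [e, norm_mul, Real.norm_eq_abs, Real.norm_of_nonneg (by positivity)]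
      have f1 := Real.abs_cos_le_one (b * t)
      have f2 : Real.cos t ^ c ≤ 1 := Real.rpow_le_one hct (Real.cos_le_one t) hc.le
      have f3 : (Real.cos t ^ 2) ^ n ≤ Real.exp (-(4/π^2) * y^2) := by
        calc (Real.cos t ^ 2) ^ n ≤ (Real.exp (-(4/π^2) * t^2)) ^ n := by gcongr
          _ = _ := by
            rw [← Real.exp_nat_mul, hyt, mul_pow, hnn]; congr 1; ring
      have f4 : 0 ≤ Real.cos t ^ c := by positivity
      have f5 : 0 ≤ (Real.cos t ^ 2) ^ n := by positivity
      calc |Real.cos (b * t)| * (Real.cos t ^ c * (Real.cos t ^ 2) ^ n)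
          ≤ 1 * (1 * (Real.cos t ^ 2) ^ n) := by gcongr
        _ ≤ _ := by simpa using f3
    · rw [indicator_of_notMem hy]
      simp only [norm_zero]; positivity
  · filter_upwards [ae_restrict_mem measurableSet_Ioi] with y hy
    have hy : 0 < y := hy
    have hsq : Tendsto (fun n : ℕ => √(n:ℝ)) atTop atTop :=
      Real.tendsto_sqrt_atTop.comp tendsto_natCast_atTop_atTop
    have ht : Tendsto (fun n : ℕ => y / √(n:ℝ)) atTop (𝓝 0) := hsq.const_div_atTop y
    have l1 : Tendsto (fun n : ℕ => Real.cos (b * (y / √(n:ℝ)))) atTop (𝓝 1) := by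
      have : Continuous fun t : ℝ => Real.cos (b * t) := by fun_prop
      simpa [Function.comp_def] using (this.tendsto 0).comp ht
    have l2 : Tendsto (fun n : ℕ => Real.cos (y / √(n:ℝ)) ^ c) atTop (𝓝 1) := by
      have : Continuous fun t : ℝ => Real.cos t ^ c :=
        Real.continuous_cos.rpow_const (fun x => Or.inr hc.le)
      simpa [Function.comp_def] using (this.tendsto 0).comp ht
    have l3 : Tendsto (fun n : ℕ => (1 + -Real.sin (y / √(n:ℝ)) ^ 2) ^ n) atTop (𝓝 (Real.exp (-1 * y^2))) := by
      apply Real.tendsto_one_add_pow_exp_of_tendsto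
      have hs : Tendsto (fun n : ℕ => -(y * Real.sinc (y / √(n:ℝ)))^2) atTop (𝓝 (-1 * y^2)) := by
        have : Continuous fun t : ℝ => -(y * Real.sinc t)^2 := by
          have := Real.continuous_sinc
          fun_prop
        have h := (this.tendsto 0).comp ht
        rw [show -(y * Real.sinc 0)^2 = -1 * y^2 by simp] at h
        exact h
      refine hs.congr' ?_
      filter_upwards [eventually_gt_atTop 0] with n hn
      have hn' : 0 < √(n:ℝ) := by positivity
      have hnn : √(n:ℝ) ^ 2 = n := Real.sq_sqrt (by positivity)
      rw [Real.sinc_of_ne_zero (by positivity)]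
      nth_rewrite 3 [← hnn]
      field_simp
    have l := l1.mul (l2.mul l3)
    simp only [one_mul] at l
    refine l.congr' ?_
    filter_upwards [eventually_gt_atTop 0, hsq.eventually_ge_atTop (y / (π/2))] with n hn hny
    have hn' : 0 < √(n:ℝ) := by positivity
    have hmem : y ∈ Ioc 0 (√(n:ℝ) * (π/2)) := ⟨hy, by rwa [div_le_iff₀ (by positivity)] at hny⟩
    simp only [F]
    rw [indicator_of_mem hmem]
    have t1 : y / √(n:ℝ) ≤ π/2 := by rw [div_le_iff₀ hn']; linarith [hmem.2]
    have t0 : 0 ≤ y / √(n:ℝ) := by positivity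
    have hct : 0 ≤ Real.cos (y / √(n:ℝ)) := Real.cos_nonneg_of_mem_Icc ⟨by linarith, t1⟩
    congr 1
    rw [Real.rpow_add_of_nonneg hct hc.le (by positivity)]
    congr 1
    have : 1 + -Real.sin (y / √(n:ℝ)) ^ 2 = Real.cos (y / √(n:ℝ)) ^ 2 := by
      linarith [Real.sin_sq_add_cos_sq (y / √(n:ℝ))]
    rw [this, ← pow_mul, ← Real.rpow_natCast]
    push_cast
    rfl

open Real Set Filter Topology MeasureTheory in
lemma aux_two (p q : ℝ) (hpq : 1 < p + q) :
    ((p+q-1)/2) * ((p+q-1)/2 + 1/2) *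
      ∫ x in (0 : ℝ)..(π / 2), Real.cos ((p - q) * x) * Real.cos x ^ (p + q - 2) =
    p * q * ∫ x in (0 : ℝ)..(π / 2), Real.cos ((p - q) * x) * Real.cos x ^ (p + q) := by
  have h1 := aux_rec (p+q-1) (p-q-1) (by linarith)
  have h2 := aux_rec' (p+q) (p-q) (by linarith)
  rw [show p - q - 1 + 1 = p - q by ring, show p + q - 1 - 1 = p + q - 2 by ring] at h1
  linear_combination (p+q)/4 * h1 + (q / 2) * h2

open Real Set Filter Topology MeasureTheory in
lemma aux_iter (p q : ℝ) (hp : 0 < p) (hq : 0 < q) (hpq : 1 < p + q) (n : ℕ) :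
    ((∏ j ∈ Finset.range n, ((p+q-1)/2 + (j:ℝ))) * ∏ j ∈ Finset.range n, ((p+q-1)/2 + 1/2 + (j:ℝ))) *
      ∫ x in (0 : ℝ)..(π / 2), Real.cos ((p - q) * x) * Real.cos x ^ (p + q - 2) =
    ((∏ j ∈ Finset.range n, (p + (j:ℝ))) * ∏ j ∈ Finset.range n, (q + (j:ℝ))) *
      ∫ x in (0 : ℝ)..(π / 2), Real.cos ((p - q) * x) * Real.cos x ^ (p + q - 2 + 2 * n) := by
  induction n with
  | zero => simp
  | succ n ih =>
    have h := aux_two (p + n) (q + n) (by have : (0:ℝ) ≤ n := n.cast_nonneg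
                                          linarith)
    rw [show p + n - (q + n) = p - q by ring, show p + n + (q + n) - 2 = p + q - 2 + 2 * (n:ℝ) by ring,
      show p + n + (q + n) = p + q - 2 + 2 * ((n + 1 : ℕ) : ℝ) by push_cast; ring] at h
    rw [Finset.prod_range_succ, Finset.prod_range_succ, Finset.prod_range_succ, Finset.prod_range_succ]
    push_cast at h ⊢
    linear_combination ((p+q-1)/2 + (n:ℝ)) * ((p+q-1)/2 + 1/2 + (n:ℝ)) * ih +
      ((∏ j ∈ Finset.range n, (p + (j:ℝ))) * ∏ j ∈ Finset.range n, (q + (j:ℝ))) * h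

open Real Set Filter Topology MeasureTheory in
theorem stmt_18 (p q : ℝ) (hp : 0 < p) (hq : 0 < q) (hpq : 1 < p + q) :
    ∫ x in (0 : ℝ)..(Real.pi / 2), Real.cos ((p - q) * x) * Real.cos x ^ (p + q - 2) =
      Real.pi * Real.Gamma (p + q - 1) /
        ((2 : ℝ) ^ (p + q - 1) * Real.Gamma p * Real.Gamma q) := by
  set I := ∫ x in (0 : ℝ)..(Real.pi / 2), Real.cos ((p - q) * x) * Real.cos x ^ (p + q - 2) with hI
  set z := (p+q-1)/2 with hz
  have hz0 : 0 < z := by rw [hz]; linarith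
  have L1 := ((Real.GammaSeq_tendsto_Gamma p).mul (Real.GammaSeq_tendsto_Gamma q)).const_mul I
  have L2 := (aux_lim (p+q) (p-q) (by linarith)).mul
    ((Real.GammaSeq_tendsto_Gamma z).mul (Real.GammaSeq_tendsto_Gamma (z+1/2)))
  have hE : ∀ᶠ n : ℕ in atTop,
      √(n:ℝ) * (∫ x in (0 : ℝ)..(π / 2), Real.cos ((p-q) * x) * Real.cos x ^ (p + q + 2 * (n:ℝ))) *
      (Real.GammaSeq z n * Real.GammaSeq (z+1/2) n) = I * (Real.GammaSeq p n * Real.GammaSeq q n) := by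
    filter_upwards [eventually_gt_atTop 0] with n hn
    have hn' : (0:ℝ) < n := by exact_mod_cast hn
    have h := aux_iter p q hp hq hpq (n+1)
    rw [← hz, ← hI, show p + q - 2 + 2 * ((n+1:ℕ):ℝ) = p + q + 2 * (n:ℝ) by push_cast; ring] at h
    have P : ∀ s : ℝ, 0 < s → 0 < ∏ j ∈ Finset.range (n+1), (s + (j:ℝ)) := fun s hs =>
      Finset.prod_pos fun j _ => by positivity
    have P1 := P p hp
    have P2 := P q hq
    have P3 := P z hz0
    have P4 := P (z+1/2) (by linarith)
    unfold Real.GammaSeq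
    have hpow : √(n:ℝ) * (n:ℝ)^z * (n:ℝ)^(z+1/2) = (n:ℝ)^p * (n:ℝ)^q := by
      rw [Real.sqrt_eq_rpow, ← Real.rpow_add hn', ← Real.rpow_add hn', ← Real.rpow_add hn']
      congr 1
      rw [hz]; ring
    generalize (∏ j ∈ Finset.range (n+1), (p + (j:ℝ))) = A at *
    generalize (∏ j ∈ Finset.range (n+1), (q + (j:ℝ))) = B at *
    generalize (∏ j ∈ Finset.range (n+1), (z + (j:ℝ))) = C at *
    generalize (∏ j ∈ Finset.range (n+1), (z + 1/2 + (j:ℝ))) = D at *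
    generalize (∫ x in (0 : ℝ)..(π / 2), Real.cos ((p-q) * x) * Real.cos x ^ (p + q + 2 * (n:ℝ))) = K at *
    have hK : K = C * D * I / (A * B) := by
      rw [h]; field_simp
    rw [hK]
    calc _ = (√(n:ℝ) * (n:ℝ)^z * (n:ℝ)^(z+1/2)) * I * (n.factorial:ℝ)^2 / (A * B) := by
          field_simp
      _ = _ := by rw [hpow]; field_simp
  have L := tendsto_nhds_unique (L2.congr' hE) L1
  rw [Real.Gamma_mul_Gamma_add_half, show 2 * z = p + q - 1 by rw [hz]; ring,
    Real.rpow_sub two_pos, Real.rpow_one] at L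
  have g1 := Real.Gamma_pos_of_pos hp
  have g2 := Real.Gamma_pos_of_pos hq
  have h2 : (0:ℝ) < 2 ^ (p+q-1) := by positivity
  have hsp : √π * √π = π := Real.mul_self_sqrt Real.pi_pos.le
  rw [eq_div_iff (by positivity)]
  have : √π / 2 * (Real.Gamma (p+q-1) * (2 / 2^(p+q-1)) * √π) = π * Real.Gamma (p+q-1) / 2^(p+q-1) := by
    field_simp
    linear_combination Real.Gamma (p+q-1) * hsp
  rw [this, div_eq_iff h2.ne'] at L
  linear_combination -L
end
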